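/- Let k ≥ 1, let F = GaloisField 2 (2k), let i ≥ 0 and ρ be integers with 1 ≤ ρ ≤ k, let t1, …, tρ be integers with 0 ≤ tj ≤ k, and let γ1, …, γρ be elements of the subfield F_{2^k}. Assume that the only z ∈ F_{2^k} with ∑_{j=1}^{ρ} γj^{2^{k−tj}} z^{2^{k−tj}} + z = 0 is z = 0, and the only z ∈ F_{2^k} with ∑_{j=1}^{ρ} γj^{2^{k−i}} z^{2^{tj}} + z = 0 is z = 0. Define G(x) = x^{2^i} ((x + x^{2^k}) + ∑_{j=1}^{ρ} γj (x + x^{2^k})^{2^{tj}}). Then for α ∈ F, the Boolean function F_α^i(x) = Tr(α G(x)) is bent if and only if α^{2^k} ≠ α. -/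

import Mathlib

open Finset

noncomputable instance (n : ℕ) : Fintype (GaloisField 2 n) := Fintype.ofFinite _

/-- The absolute trace of `GaloisField 2 n` over `ZMod 2`. -/
noncomputable def gTr (n : ℕ) : GaloisField 2 n → ZMod 2 :=
  Algebra.trace (ZMod 2) (GaloisField 2 n)

/-- A Boolean function on `GaloisField 2 n` is bent if all its Walsh values
square to `2^n`. -/
def IsBent {n : ℕ} (f : GaloisField 2 n → ZMod 2) : Prop :=
  ∀ lam : GaloisField 2 n,
    (∑ x : GaloisField 2 n, (-1 : ℤ) ^ (f x + gTr n (lam * x)).val) ^ 2 = 2 ^ n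

section Characters

lemma neg_one_pow_val_add (a b : ZMod 2) :
    (-1 : ℤ) ^ (a + b).val = (-1) ^ a.val * (-1) ^ b.val := by
  revert a b; decide

lemma neg_one_pow_val_add_one (a : ZMod 2) : (-1 : ℤ) ^ (a + 1).val = -(-1) ^ a.val := by
  revert a; decide

variable {G : Type*} [AddCommGroup G] [Fintype G]

/-- A sign sum vanishes when some translation flips every sign. -/
lemma sum_neg_one_pow_val_eq_zero (g : G → ZMod 2) (a : G) (h : ∀ x, g (x + a) = g x + 1) :
    ∑ x, (-1 : ℤ) ^ (g x).val = 0 := by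
  have h1 : ∑ x, (-1 : ℤ) ^ (g x).val = ∑ x, (-1 : ℤ) ^ (g (x + a)).val :=
    (Equiv.sum_comp (Equiv.addRight a) fun x => (-1 : ℤ) ^ (g x).val).symm
  simp only [h, neg_one_pow_val_add_one, Finset.sum_neg_distrib] at h1
  omega

/-- A sign sum squares to the size of the group when every nontrivial derivative is balanced. -/
lemma sq_sum_neg_one_pow_val (g : G → ZMod 2)
    (h : ∀ y ≠ 0, ∃ a, ∀ x, g (x + a + y) + g (x + a) = g (x + y) + g x + 1) :
    (∑ x, (-1 : ℤ) ^ (g x).val) ^ 2 = Fintype.card G := by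
  have h1 : (∑ x, (-1 : ℤ) ^ (g x).val) ^ 2 = ∑ y, ∑ x, (-1 : ℤ) ^ (g (x + y) + g x).val := by
    rw [sum_comm, sq, sum_mul]
    refine sum_congr rfl fun x _ => ?_
    simp only [neg_one_pow_val_add, ← sum_mul]
    rw [mul_comm]
    congr 1
    exact (Equiv.sum_comp (Equiv.addLeft x) fun z => (-1 : ℤ) ^ (g z).val).symm
  rw [h1, Finset.sum_eq_single 0]
  · simp [CharTwo.add_self_eq_zero]
  · intro y _ hy
    obtain ⟨a, ha⟩ := h y hy
    exact sum_neg_one_pow_val_eq_zero (fun x => g (x + y) + g x) a ha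
  · simp

end Characters

section Trace

variable {n : ℕ}

lemma gTr_add (x y : GaloisField 2 n) : gTr n (x + y) = gTr n x + gTr n y :=
  map_add (Algebra.trace (ZMod 2) (GaloisField 2 n)) x y

lemma gTr_zero : gTr n 0 = 0 := map_zero (Algebra.trace (ZMod 2) (GaloisField 2 n))

lemma gTr_sum {ι : Type*} (s : Finset ι) (f : ι → GaloisField 2 n) :
    gTr n (∑ j ∈ s, f j) = ∑ j ∈ s, gTr n (f j) :=
  map_sum (Algebra.trace (ZMod 2) (GaloisField 2 n)) f s

lemma gTr_pow_two_pow (m : ℕ) (x : GaloisField 2 n) : gTr n (x ^ 2 ^ m) = gTr n x := by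
  induction m with
  | zero => simp
  | succ m ih =>
    rw [pow_succ, pow_mul, ← ih]
    have := Algebra.trace_eq_of_algEquiv
      (FiniteField.frobeniusAlgEquivOfAlgebraic (ZMod 2) (GaloisField 2 n)) (x ^ 2 ^ m)
    simpa [gTr] using this

lemma eq_zero_of_gTr_mul_eq_zero {a : GaloisField 2 n} (h : ∀ x, gTr n (a * x) = 0) : a = 0 :=
  (traceForm_nondegenerate (ZMod 2) (GaloisField 2 n)).1 a h

lemma exists_gTr_eq_one : ∃ a : GaloisField 2 n, gTr n a = 1 :=
  Algebra.trace_surjective (ZMod 2) (GaloisField 2 n) 1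

lemma galoisField_two_card (hn : n ≠ 0) : Fintype.card (GaloisField 2 n) = 2 ^ n := by
  rw [← Nat.card_eq_fintype_card, GaloisField.card 2 n hn]

lemma galoisField_two_pow_card (hn : n ≠ 0) (x : GaloisField 2 n) : x ^ 2 ^ n = x := by
  rw [← galoisField_two_card hn, FiniteField.pow_card]

lemma exists_pow_two_pow_eq (m : ℕ) (x : GaloisField 2 n) : ∃ y, y ^ 2 ^ m = x := by
  obtain ⟨y, hy⟩ := (Finite.injective_iff_surjective.1
    (iterateFrobenius (GaloisField 2 n) 2 m).injective) x
  exact ⟨y, hy⟩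

/-- The trace adjoint of `u ↦ c * u ^ 2 ^ m`. -/
lemma gTr_mul_pow_two_pow {m : ℕ} (hn : n ≠ 0) (hm : m ≤ n) (w c u : GaloisField 2 n) :
    gTr n (w * (c * u ^ 2 ^ m)) = gTr n ((c * w) ^ 2 ^ (n - m) * u) := by
  rw [← gTr_pow_two_pow (n - m) (w * (c * u ^ 2 ^ m)), ← mul_assoc, mul_pow, ← pow_mul,
    ← pow_add, Nat.add_sub_cancel' hm, galoisField_two_pow_card hn, mul_comm w]

end Trace

section RelativeTrace

variable {k : ℕ}

lemma add_pow_two_pow_add (k : ℕ) {n : ℕ} (x y : GaloisField 2 n) :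
    (x + y) ^ 2 ^ k = x ^ 2 ^ k + y ^ 2 ^ k := add_pow_char_pow x y 2 k

/-- The relative trace `x ↦ x + x ^ 2 ^ k`, as an additive map. -/
noncomputable def relTr (k : ℕ) : GaloisField 2 (2 * k) →+ GaloisField 2 (2 * k) :=
  AddMonoidHom.mk' (fun x => x + x ^ 2 ^ k) fun x y => by rw [add_pow_two_pow_add]; ring

lemma relTr_apply (x : GaloisField 2 (2 * k)) : relTr k x = x + x ^ 2 ^ k := rfl

lemma relTr_eq_zero_iff {x : GaloisField 2 (2 * k)} : relTr k x = 0 ↔ x ^ 2 ^ k = x := by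
  rw [relTr_apply, CharTwo.add_eq_zero, eq_comm]

lemma relTr_pow_eq_self (hk : 1 ≤ k) (x : GaloisField 2 (2 * k)) :
    relTr k x ^ 2 ^ k = relTr k x := by
  rw [relTr_apply, add_pow_two_pow_add, ← pow_mul, ← pow_add, ← two_mul,
    galoisField_two_pow_card (by omega), add_comm]

lemma relTr_pow_two_pow (m : ℕ) (x : GaloisField 2 (2 * k)) :
    relTr k (x ^ 2 ^ m) = relTr k x ^ 2 ^ m := by
  rw [relTr_apply, relTr_apply, add_pow_two_pow_add, pow_right_comm]

lemma relTr_mul_left {c : GaloisField 2 (2 * k)} (hc : c ^ 2 ^ k = c) (x : GaloisField 2 (2 * k)) :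
    relTr k (c * x) = c * relTr k x := by
  rw [relTr_apply, relTr_apply, mul_pow, hc, mul_add]

lemma gTr_relTr (x : GaloisField 2 (2 * k)) : gTr (2 * k) (relTr k x) = 0 := by
  rw [relTr_apply, gTr_add, gTr_pow_two_pow, CharTwo.add_self_eq_zero]

/-- The relative trace is self-adjoint for the absolute trace form. -/
lemma gTr_mul_relTr (hk : 1 ≤ k) (x y : GaloisField 2 (2 * k)) :
    gTr (2 * k) (x * relTr k y) = gTr (2 * k) (relTr k x * y) := by
  have h := gTr_mul_pow_two_pow (m := k) (by omega) (by omega) x 1 y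
  rw [one_mul, one_mul, show 2 * k - k = k by omega] at h
  rw [relTr_apply, relTr_apply, mul_add, add_mul, gTr_add, gTr_add, h]

end RelativeTrace

section Bent

variable {k : ℕ}

lemma injective_of_gTr_adjoint {n : ℕ} {L M : GaloisField 2 n →+ GaloisField 2 n}
    (hLM : ∀ w u, gTr n (w * L u) = gTr n (M w * u)) (hM : Function.Injective M) :
    Function.Injective L := by
  refine (injective_iff_map_eq_zero L).2 fun u hu => eq_zero_of_gTr_mul_eq_zero fun x => ?_
  obtain ⟨s, rfl⟩ := Finite.injective_iff_surjective.1 hM x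
  rw [mul_comm, ← hLM, hu, mul_zero, gTr_zero]

lemma relTr_comm_of_gTr_adjoint (hk : 1 ≤ k)
    {L M : GaloisField 2 (2 * k) →+ GaloisField 2 (2 * k)}
    (hLM : ∀ w u, gTr (2 * k) (w * L u) = gTr (2 * k) (M w * u))
    (hL : ∀ x, L (relTr k x) = relTr k (L x)) (w : GaloisField 2 (2 * k)) :
    M (relTr k w) = relTr k (M w) := by
  rw [← sub_eq_zero]
  refine eq_zero_of_gTr_mul_eq_zero fun u => ?_
  rw [CharTwo.sub_eq_add, add_mul, gTr_add, ← hLM, ← gTr_mul_relTr hk, ← gTr_mul_relTr hk,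
    ← hLM, hL, CharTwo.add_self_eq_zero]

/-- The quadratic form `Tr (α x ^ 2 ^ i L (Tr_k x))` is bent exactly for `α` outside the subfield
of order `2 ^ k`, when `L` commutes with the relative trace and has an injective adjoint `M`. -/
theorem isBent_gTr_mul_relTr_iff (hk : 1 ≤ k) (i : ℕ)
    {L M : GaloisField 2 (2 * k) →+ GaloisField 2 (2 * k)}
    (hLM : ∀ w u, gTr (2 * k) (w * L u) = gTr (2 * k) (M w * u))
    (hL : ∀ x, L (relTr k x) = relTr k (L x)) (hM : Function.Injective M)
    (α : GaloisField 2 (2 * k)) :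
    IsBent (fun x => gTr (2 * k) (α * (x ^ 2 ^ i * L (relTr k x)))) ↔ α ^ 2 ^ k ≠ α := by
  have h2k : 2 * k ≠ 0 := by omega
  constructor
  · intro hbent hα
    obtain ⟨c, hc⟩ := exists_gTr_eq_one (n := 2 * k)
    have hW := hbent c
    rw [sum_neg_one_pow_val_eq_zero _ 1] at hW
    · exact absurd hW (by positivity)
    · intro x
      have h1 : relTr k (1 : GaloisField 2 (2 * k)) = 0 := relTr_eq_zero_iff.2 (one_pow _)
      have h2 : gTr (2 * k) (α * L (relTr k x)) = 0 := by
        rw [hL, ← relTr_mul_left hα, gTr_relTr]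
      simp only [map_add, h1, add_zero, add_pow_two_pow_add, one_pow, add_mul, mul_add, one_mul,
        mul_one, gTr_add, h2, hc]
      ring
  · intro hα lam
    rw [sq_sum_neg_one_pow_val, galoisField_two_card h2k]
    · norm_cast
    intro y hy
    by_contra! hne
    have hB : ∀ a, gTr (2 * k) (α * (a ^ 2 ^ i * L (relTr k y))) +
        gTr (2 * k) (α * (y ^ 2 ^ i * L (relTr k a))) = 0 := by
      intro a
      by_contra h0
      obtain ⟨x, hx⟩ := hne a
      refine hx ?_
      have h1 := (by decide : ∀ b : ZMod 2, b ≠ 0 → b = 1) _ h0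
      simp only [map_add, add_pow_two_pow_add, add_mul, mul_add, gTr_add]
      have hc : (2 : ZMod 2) = 0 := rfl
      linear_combination h1 + hc * (gTr (2 * k) (α * (a ^ 2 ^ i * L (relTr k x))) +
        gTr (2 * k) (α * (x ^ 2 ^ i * L (relTr k a))) +
        gTr (2 * k) (α * (a ^ 2 ^ i * L (relTr k a))) + gTr (2 * k) (lam * a))
    have hy0 : relTr k y = 0 := by
      have h0 : relTr k (α * L (relTr k y)) = 0 := by
        refine eq_zero_of_gTr_mul_eq_zero fun r => ?_
        obtain ⟨s, rfl⟩ := exists_pow_two_pow_eq i r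
        have h1 := hB (relTr k s)
        rw [relTr_eq_zero_iff.2 (relTr_pow_eq_self hk s), map_zero, mul_zero, mul_zero, gTr_zero,
          add_zero, ← relTr_pow_two_pow] at h1
        rw [← gTr_mul_relTr hk, ← h1]
        ring_nf
      rw [mul_comm α, hL, relTr_mul_left (relTr_pow_eq_self hk _), mul_eq_zero, ← hL] at h0
      refine h0.elim (fun h => ?_) fun h => absurd (relTr_eq_zero_iff.1 h) hα
      exact (map_eq_zero_iff L (injective_of_gTr_adjoint hLM hM)).1 h
    simp only [hy0, map_zero, mul_zero, gTr_zero, zero_add] at hB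
    have h0 : relTr k (M (α * y ^ 2 ^ i)) = 0 := by
      refine eq_zero_of_gTr_mul_eq_zero fun a => ?_
      rw [← gTr_mul_relTr hk, ← hLM, mul_assoc, hB]
    rw [← relTr_comm_of_gTr_adjoint hk hLM hL, map_eq_zero_iff M hM, mul_comm α,
      relTr_mul_left, mul_eq_zero, relTr_eq_zero_iff] at h0
    · exact h0.elim (fun h => hy (eq_zero_of_pow_eq_zero h)) hα
    · rw [pow_right_comm, relTr_eq_zero_iff.1 hy0]

end Bent

section Linearized

variable {n : ℕ} {ι : Type*} [Fintype ι]

/-- The linearized polynomial map `u ↦ u + ∑ j, γ j * u ^ 2 ^ t j`. -/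
noncomputable def linearized (γ : ι → GaloisField 2 n) (t : ι → ℕ) :
    GaloisField 2 n →+ GaloisField 2 n :=
  AddMonoidHom.mk' (fun u => u + ∑ j, γ j * u ^ 2 ^ t j) fun x y => by
    simp only [add_pow_two_pow_add, mul_add, Finset.sum_add_distrib]
    ring

/-- The adjoint of `linearized γ t` for the trace form, provided every `t j` is at most `n`. -/
noncomputable def linearizedAdjoint (γ : ι → GaloisField 2 n) (t : ι → ℕ) :
    GaloisField 2 n →+ GaloisField 2 n :=
  AddMonoidHom.mk' (fun w => w + ∑ j, (γ j * w) ^ 2 ^ (n - t j)) fun x y => by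
    simp only [mul_add, add_pow_two_pow_add, Finset.sum_add_distrib]
    ring

lemma linearized_apply (γ : ι → GaloisField 2 n) (t : ι → ℕ) (u : GaloisField 2 n) :
    linearized γ t u = u + ∑ j, γ j * u ^ 2 ^ t j := rfl

lemma linearizedAdjoint_apply (γ : ι → GaloisField 2 n) (t : ι → ℕ) (w : GaloisField 2 n) :
    linearizedAdjoint γ t w = w + ∑ j, (γ j * w) ^ 2 ^ (n - t j) := rfl

lemma gTr_mul_linearized (hn : n ≠ 0) (γ : ι → GaloisField 2 n) {t : ι → ℕ} (ht : ∀ j, t j ≤ n)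
    (w u : GaloisField 2 n) :
    gTr n (w * linearized γ t u) = gTr n (linearizedAdjoint γ t w * u) := by
  simp only [linearized_apply, linearizedAdjoint_apply, mul_add, add_mul, gTr_add, Finset.mul_sum,
    Finset.sum_mul, gTr_sum, gTr_mul_pow_two_pow hn (ht _)]

variable {k : ℕ} {γ : ι → GaloisField 2 (2 * k)}

lemma linearized_relTr (hγ : ∀ j, γ j ^ 2 ^ k = γ j) (t : ι → ℕ) (x : GaloisField 2 (2 * k)) :
    linearized γ t (relTr k x) = relTr k (linearized γ t x) := by
  simp only [linearized_apply, map_add, map_sum, relTr_mul_left (hγ _), relTr_pow_two_pow]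

lemma linearizedAdjoint_apply_of_pow_eq_self (hγ : ∀ j, γ j ^ 2 ^ k = γ j) {t : ι → ℕ}
    (ht : ∀ j, t j ≤ k) {z : GaloisField 2 (2 * k)} (hz : z ^ 2 ^ k = z) :
    linearizedAdjoint γ t z = (∑ j, γ j ^ 2 ^ (k - t j) * z ^ 2 ^ (k - t j)) + z := by
  rw [linearizedAdjoint_apply, add_comm]
  congr 1
  refine Finset.sum_congr rfl fun j _ => ?_
  rw [show 2 * k - t j = k + (k - t j) by have := ht j; omega, pow_add, pow_mul, mul_pow, hγ, hz,
    mul_pow]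

end Linearized

theorem stmt_10 (k : ℕ) (hk : 1 ≤ k) (i ρ : ℕ) (hρ1 : 1 ≤ ρ) (hρk : ρ ≤ k)
    (t : Fin ρ → ℕ) (ht : ∀ j, t j ≤ k)
    (γ : Fin ρ → GaloisField 2 (2 * k)) (hγ : ∀ j, (γ j) ^ 2 ^ k = γ j)
    (h1 : ∀ z : GaloisField 2 (2 * k), z ^ 2 ^ k = z →
      (∑ j, (γ j) ^ 2 ^ (k - t j) * z ^ 2 ^ (k - t j)) + z = 0 → z = 0)
    (h2 : ∀ z : GaloisField 2 (2 * k), z ^ 2 ^ k = z →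
      (∑ j, (γ j) ^ 2 ^ (k - i) * z ^ 2 ^ (t j)) + z = 0 → z = 0)
    (α : GaloisField 2 (2 * k)) :
    IsBent (fun x : GaloisField 2 (2 * k) =>
      gTr (2 * k) (α * (x ^ 2 ^ i *
        ((x + x ^ 2 ^ k) + ∑ j, γ j * (x + x ^ 2 ^ k) ^ 2 ^ (t j))))) ↔
      α ^ 2 ^ k ≠ α := by
  have hLM := gTr_mul_linearized (by omega) γ fun j => (ht j).trans (by omega : k ≤ 2 * k)
  have hL := linearized_relTr hγ t
  have hker : ∀ z, z ^ 2 ^ k = z → linearizedAdjoint γ t z = 0 → z = 0 := fun z hz h =>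
    h1 z hz (by rwa [← linearizedAdjoint_apply_of_pow_eq_self hγ ht hz])
  have hM : Function.Injective (linearizedAdjoint γ t) := by
    refine (injective_iff_map_eq_zero _).2 fun w hw => ?_
    have hTw : relTr k w = 0 := by
      refine hker _ (relTr_pow_eq_self hk w) ?_
      rw [relTr_comm_of_gTr_adjoint hk hLM hL, hw, map_zero]
    exact hker w (relTr_eq_zero_iff.1 hTw) hw
  exact isBent_gTr_mul_relTr_iff hk i hLM hL hM α
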